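/- Chang's Conjecture implies that there is no strong ω₂-chain of subsets of ω₁: if for every function F from finite tuples of ordinals below ω₂ to ordinals below ω₂ there exists a set X of ordinals below ω₂ closed under F with |X| = ℵ₁ and |X ∩ ω₁| ≤ ℵ₀, then there is no sequence ⟨X_α : α < ω₂⟩ of subsets of ω₁ such that for all α < β < ω₂, X_β \ X_α has cardinality ℵ₁ and X_α \ X_β is finite. (Theorem of Koszmider, stated in the paper.) -/

import Mathlib

open Cardinal Ordinal

/-- The type of countable ordinals, i.e. ordinals below `ω₁`. -/
abbrev Omega1 := {ξ : Ordinal.{0} // ξ < (Cardinal.aleph 1).ord}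

/-- The type of ordinals below `ω₂`. -/
abbrev Omega2 := {ξ : Ordinal.{0} // ξ < (Cardinal.aleph 2).ord}

/-- Chang's Conjecture: for every function `F` from finite tuples of ordinals below `ω₂`
to ordinals below `ω₂` there is a set `X ⊆ ω₂` closed under `F` with `|X| = ℵ₁` and
`|X ∩ ω₁| ≤ ℵ₀`. -/
def ChangsConjecture : Prop :=
  ∀ F : List Omega2 → Omega2,
    ∃ X : Set Omega2,
      (∀ l : List Omega2, (∀ x ∈ l, x ∈ X) → F l ∈ X) ∧
      Cardinal.mk ↥X = Cardinal.aleph 1 ∧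
      Cardinal.mk ↥{x : Omega2 | x ∈ X ∧ x.val < (Cardinal.aleph 1).ord} ≤ Cardinal.aleph0

/-- Sets of fewer than `c` ordinals below a regular `c` are strictly bounded below `c`. -/
theorem exists_forall_lt_of_mk_lt {c : Cardinal.{0}} (hc : c.IsRegular)
    (s : Set {ξ : Ordinal.{0} // ξ < c.ord}) (hs : #s < Cardinal.lift.{1} c) :
    ∃ b : {ξ : Ordinal.{0} // ξ < c.ord}, ∀ a ∈ s, a < b := by
  have hlim : Order.IsSuccLimit c.ord := Cardinal.isSuccLimit_ord hc.aleph0_le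
  have hlt : (⨆ a : s, Order.succ a.1.1) < c.ord := by
    apply Ordinal.lift_iSup_lt_of_lt_cof
    · rwa [← Ordinal.lift_cof, hc.cof_ord, Cardinal.lift_uzero]
    · exact fun a ↦ hlim.succ_lt a.1.2
  have : Small.{0} s := by
    have : Small.{0} (Set.Iio c.ord) := inferInstance
    exact @small_subtype _ this s
  refine ⟨⟨_, hlt⟩, fun a ha ↦ Subtype.mk_lt_mk.2 ?_⟩
  exact (Order.lt_succ a.1).trans_le
    (le_ciSup (f := fun a : s ↦ Order.succ a.1.1) Ordinal.bddAbove_of_small ⟨a, ha⟩)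

/-- Initial segments below a cardinal `c` have size less than `c`. -/
theorem mk_Iio_lt_lift {c : Cardinal.{0}} (b : {ξ : Ordinal.{0} // ξ < c.ord}) :
    #(Set.Iio b) < Cardinal.lift.{1} c := by
  have h : #(Set.Iio b) ≤ #(Set.Iio b.1) :=
    Cardinal.mk_le_of_injective (f := fun a : Set.Iio b ↦ (⟨a.1.1, a.2⟩ : Set.Iio b.1))
      fun _ _ h ↦ Subtype.ext (Subtype.ext (congrArg (fun t : Set.Iio b.1 ↦ t.1) h))
  rw [Cardinal.mk_Iio_ordinal] at h
  exact h.trans_lt (Cardinal.lift_lt.2 (Cardinal.lt_ord.1 b.2))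

theorem isRegular_aleph_two : (ℵ_ 2 : Cardinal.{0}).IsRegular := by
  simpa [one_add_one_eq_two] using Cardinal.isRegular_aleph_add_one 1

theorem mk_omega1 : #Omega1 = ℵ_ 1 := by
  have h := Cardinal.mk_Iio_ordinal (Cardinal.aleph 1).ord
  rwa [Cardinal.card_ord, Cardinal.lift_aleph, Ordinal.lift_one] at h

theorem Omega1.exists_forall_lt {s : Set Omega1} (hs : s.Countable) : ∃ b, ∀ a ∈ s, a < b := by
  refine exists_forall_lt_of_mk_lt Cardinal.isRegular_aleph_one s ?_
  simpa using hs.le_aleph0.trans_lt Cardinal.aleph0_lt_aleph_one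

theorem Omega1.countable_Iio (b : Omega1) : (Set.Iio b).Countable := by
  have := mk_Iio_lt_lift b
  rw [Cardinal.lift_aleph, Ordinal.lift_one] at this
  rwa [← Cardinal.le_aleph0_iff_set_countable, ← Order.lt_succ_iff, Cardinal.succ_aleph0]

theorem Omega2.exists_forall_lt {s : Set Omega2} (hs : #s ≤ ℵ_ 1) : ∃ b, ∀ a ∈ s, a < b := by
  refine exists_forall_lt_of_mk_lt isRegular_aleph_two s (hs.trans_lt ?_)
  simp

theorem Omega2.mk_Iio_le (b : Omega2) : #(Set.Iio b) ≤ ℵ_ 1 := by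
  have := mk_Iio_lt_lift b
  rw [Cardinal.lift_aleph] at this
  rw [← Order.lt_succ_iff, Cardinal.succ_aleph]
  simpa [one_add_one_eq_two] using this

/-- The inclusion of `ω₁` in `ω₂`. -/
def Omega1.toOmega2 (x : Omega1) : Omega2 :=
  ⟨x.1, x.2.trans (Cardinal.ord_lt_ord.2 (Cardinal.aleph_lt_aleph.2 one_lt_two))⟩

theorem Omega1.toOmega2_injective : Function.Injective Omega1.toOmega2 :=
  fun _ _ h ↦ Subtype.ext (congrArg (fun t : Omega2 ↦ t.1) h)

/-- A version of Chang's Conjecture for one unary function on `ω₂` and two binary functions from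
`ω₂` to `ω₁`. -/
theorem ChangsConjecture.exists_closed (CC : ChangsConjecture) (g : Omega2 → Omega2)
    (c e : Omega2 → Omega2 → Omega1) :
    ∃ N : Set Omega2, #N = ℵ_ 1 ∧ (∀ a ∈ N, g a ∈ N) ∧
      ∃ K : Set Omega1, K.Countable ∧ ∀ a ∈ N, ∀ b ∈ N, c a b ∈ K ∧ e a b ∈ K := by
  obtain ⟨z, -⟩ := Omega2.exists_forall_lt (s := ∅) (by simp)
  obtain ⟨N, hF, hN, hN1⟩ := CC fun
    | [a] => g a
    | [a, b] => (c a b).toOmega2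
    | [a, b, _] => (e a b).toOmega2
    | _ => z
  refine ⟨N, hN, fun a ha ↦ hF [a] (by simpa), Omega1.toOmega2 ⁻¹' N, ?_, fun a ha b hb ↦ ⟨?_, ?_⟩⟩
  · have : {x : Omega2 | x ∈ N ∧ x.val < (Cardinal.aleph 1).ord}.Countable :=
      Cardinal.le_aleph0_iff_set_countable.1 hN1
    refine (this.preimage Omega1.toOmega2_injective).mono ?_
    exact fun x hx ↦ ⟨hx, x.2⟩
  · exact hF [a, b] (by simp [ha, hb])
  · exact hF [a, b, a] (by simp [ha, hb])

/-- Under Chang's Conjecture, a sequence of subsets of `ω₁` of length `ω₂` that increases modulo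
finite sets has two terms whose difference is countable. -/
theorem ChangsConjecture.exists_countable_diff (CC : ChangsConjecture) (Y : Omega2 → Set Omega1)
    (hY : ∀ a b, a < b → (Y a \ Y b).Finite) : ∃ a b, a < b ∧ (Y b \ Y a).Countable := by
  by_contra! hunc
  -- `c a b` bounds `Y a \ Y b`
  have hc : ∀ a b, ∃ x, a < b → ∀ y ∈ Y a \ Y b, y < x := fun a b ↦ by
    by_cases hab : a < b
    · obtain ⟨x, hx⟩ := Omega1.exists_forall_lt (hY a b hab).countable
      exact ⟨x, fun _ ↦ hx⟩
    · obtain ⟨x, -⟩ := Omega1.exists_forall_lt Set.countable_empty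
      exact ⟨x, fun h ↦ absurd h hab⟩
  choose c hc using hc
  -- `e · b` injects the predecessors of `b` into `ω₁`
  have he : ∀ b : Omega2, ∃ f : Omega2 → Omega1, Set.InjOn f (Set.Iio b) := fun b ↦ by
    have h : #(Set.Iio b) ≤ #Omega1 := (Omega2.mk_Iio_le b).trans_eq mk_omega1.symm
    obtain ⟨f⟩ := h
    obtain ⟨z, -⟩ := Omega1.exists_forall_lt Set.countable_empty
    refine ⟨fun a ↦ if h : a < b then f ⟨a, h⟩ else z, ?_⟩
    intro x hx y hy hxy
    have hxb : x < b := hx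
    have hyb : y < b := hy
    simp only [hxb, hyb, dite_true] at hxy
    exact Subtype.ext_iff.1 (f.injective hxy)
  choose e he using he
  -- `g a` bounds the first indices whose sets meet a countable interval minus `Y a` infinitely often
  have hg : ∀ a, ∃ z, ∀ u v : Omega1, (∃ d, ((Y d \ Y a) ∩ Set.Ico u v).Infinite) →
      ∃ d < z, ((Y d \ Y a) ∩ Set.Ico u v).Infinite := fun a ↦ by
    have : ∀ p : Omega1 × Omega1, ∃ d, (∃ d, ((Y d \ Y a) ∩ Set.Ico p.1 p.2).Infinite) →
        ((Y d \ Y a) ∩ Set.Ico p.1 p.2).Infinite := fun p ↦ by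
      by_cases h : ∃ d, ((Y d \ Y a) ∩ Set.Ico p.1 p.2).Infinite
      · exact ⟨h.choose, fun _ ↦ h.choose_spec⟩
      · exact ⟨a, fun hex ↦ absurd hex h⟩
    choose w hw using this
    have hcard : #(Set.range w) ≤ ℵ_ 1 := by
      refine Cardinal.mk_range_le.trans_eq ?_
      rw [Cardinal.mk_prod, mk_omega1]
      simp [Cardinal.aleph_mul_aleph]
    obtain ⟨z, hz⟩ := Omega2.exists_forall_lt hcard
    exact ⟨z, fun u v h ↦ ⟨w (u, v), hz _ ⟨_, rfl⟩, hw (u, v) h⟩⟩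
  choose g hg using hg
  obtain ⟨N, hN, hgN, K, hK, hKN⟩ := CC.exists_closed g c fun a b ↦ e b a
  obtain ⟨δ, hδ⟩ := Omega1.exists_forall_lt hK
  have hNunc : ¬ N.Countable := fun h ↦ by
    have := h.le_aleph0
    rw [hN] at this
    exact this.not_gt Cardinal.aleph0_lt_aleph_one
  have hmono : ∀ a ∈ N, ∀ b ∈ N, a ≤ b → ∀ x ∈ Y a, δ ≤ x → x ∈ Y b := by
    intro a ha b hb hab x hx hδx
    obtain rfl | hab := hab.eq_or_lt
    · exact hx
    · by_contra hxb
      exact ((hc a b hab x ⟨hx, hxb⟩).trans (hδ _ (hKN a ha b hb).1)).not_ge hδx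
  have hinit : ∀ b ∈ N, (N ∩ Set.Iic b).Countable := by
    intro b hb
    have h : (N ∩ Set.Iio b).Countable :=
      Set.MapsTo.countable_of_injOn (f := e b) (fun a ha ↦ (hKN a ha.1 b hb).2)
        ((he b).mono Set.inter_subset_right) hK
    refine (h.insert b).mono fun a ha ↦ ?_
    exact (le_iff_eq_or_lt.1 ha.2).imp id fun h ↦ ⟨ha.1, h⟩
  have hbdd : ∀ C ⊆ N, C.Countable → ∃ b ∈ N, ∀ a ∈ C, a ≤ b := by
    intro C hC hCc
    by_contra! h
    refine hNunc ((hCc.biUnion fun a ha ↦ hinit a (hC ha)).mono fun b hb ↦ ?_)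
    obtain ⟨a, ha, hba⟩ := h b hb
    exact Set.mem_biUnion ha ⟨hb, hba.le⟩
  obtain ⟨σ, hσ⟩ := Omega2.exists_forall_lt hN.le
  obtain ⟨τ, hτ⟩ := Omega2.exists_forall_lt (s := {σ})
    (by simpa using Cardinal.one_le_aleph0.trans (Cardinal.aleph0_le_aleph 1))
  replace hτ : σ < τ := hτ σ rfl
  -- a countable interval above `δ` meeting `Y τ \ Y σ` in an infinite set
  obtain ⟨η, hη⟩ : ∃ η, ((Y τ \ Y σ) ∩ Set.Ico δ η).Infinite := by
    have h : ((Y τ \ Y σ) \ Set.Iio δ).Infinite := fun h ↦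
      hunc σ τ hτ ((h.countable.union (Omega1.countable_Iio δ)).mono fun x hx ↦ by
        by_cases hxδ : x < δ
        · exact Or.inr hxδ
        · exact Or.inl ⟨hx, hxδ⟩)
    let t : ℕ → Omega1 := fun n ↦ (h.natEmbedding _ n).1
    have ht : ∀ n, t n ∈ (Y τ \ Y σ) \ Set.Iio δ := fun n ↦ (h.natEmbedding _ n).2
    obtain ⟨η, hη⟩ := Omega1.exists_forall_lt (Set.countable_range t)
    refine ⟨η, (Set.infinite_range_of_injective
      (Subtype.val_injective.comp (h.natEmbedding _).injective)).mono ?_⟩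
    rintro _ ⟨n, rfl⟩
    exact ⟨(ht n).1, not_lt.1 (ht n).2, hη _ ⟨n, rfl⟩⟩
  -- some `γ ∈ N` already captures the union over `N` on this interval
  obtain ⟨γ, hγ, hγU⟩ : ∃ γ ∈ N, ∀ a ∈ N, ∀ x ∈ Y a, x ∈ Set.Ico δ η → x ∈ Y γ := by
    have hp : ∀ x, ∃ p ∈ N, (∃ a ∈ N, x ∈ Y a) → x ∈ Y p := fun x ↦ by
      by_cases h : ∃ a ∈ N, x ∈ Y a
      · obtain ⟨a, ha, hx⟩ := h
        exact ⟨a, ha, fun _ ↦ hx⟩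
      · obtain ⟨a, ha⟩ := Set.nonempty_iff_ne_empty.2 fun h : N = ∅ ↦ hNunc (by simp [h])
        exact ⟨a, ha, fun hex ↦ absurd hex h⟩
    choose p hpN hp using hp
    obtain ⟨γ, hγ, hγp⟩ := hbdd (p '' Set.Ico δ η) (by rintro _ ⟨x, -, rfl⟩; exact hpN x)
      (((Omega1.countable_Iio η).mono fun x hx ↦ hx.2).image p)
    exact ⟨γ, hγ, fun a ha x hx hxI ↦
      hmono (p x) (hpN x) γ hγ (hγp _ ⟨x, hxI, rfl⟩) x (hp x ⟨a, ha, hx⟩) hxI.1⟩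
  have hτγ : ((Y τ \ Y γ) ∩ Set.Ico δ η).Infinite := by
    refine (hη.sdiff (hY γ σ (hσ γ hγ))).mono ?_
    rintro x ⟨⟨⟨hxτ, hxσ⟩, hxI⟩, hx⟩
    exact ⟨⟨hxτ, fun h ↦ hx ⟨h, hxσ⟩⟩, hxI⟩
  obtain ⟨d, hd, hdinf⟩ := hg γ δ η ⟨τ, hτγ⟩
  obtain ⟨x, ⟨⟨hxd, hxγ⟩, hxI⟩, hx⟩ := (hdinf.sdiff (hY d (g γ) hd)).nonempty
  exact hxγ (hγU (g γ) (hgN γ hγ) x (by_contra fun h ↦ hx ⟨hxd, h⟩) hxI)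

/-- Chang's Conjecture implies that there is no strong `ω₂`-chain of subsets of `ω₁`. -/
theorem no_strong_omega2_chain_of_subsets_of_changsConjecture
    (CC : ChangsConjecture) :
    ¬ ∃ X : Ordinal → Set Omega1,
        ∀ α β : Ordinal, α < β → β < (Cardinal.aleph 2).ord →
          Cardinal.mk ↥(X β \ X α) = Cardinal.aleph 1 ∧ (X α \ X β).Finite := by
  rintro ⟨X, hX⟩
  have key (a b : Omega2) (hab : a < b) := hX (Ordinal.lift a.1) (Ordinal.lift b.1)
    (Ordinal.lift_lt.2 hab) (by simpa using b.2)
  obtain ⟨a, b, hab, h⟩ :=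
    CC.exists_countable_diff (fun a ↦ X (Ordinal.lift a.1)) fun a b hab ↦ (key a b hab).2
  have := h.le_aleph0
  rw [(key a b hab).1] at this
  exact this.not_gt Cardinal.aleph0_lt_aleph_one
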